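/- Let H be a real inner product space and B : H → H → ℝ a symmetric bilinear form that is positive semidefinite, i.e. B(v, v) ≥ 0 for all v ∈ H. Let n be a natural number and let (ψ_j)_{j=1}^{n} and (φ_j)_{j=1}^{n} be families in H satisfying the biorthogonality condition ⟨ψ_i, φ_j⟩ = δ_{ij} for all 1 ≤ i, j ≤ n, and suppose that B(ψ_i, v) = 0 for every index i and every v ∈ H with ⟨v, φ_j⟩ = 0 for all j. Then for every u ∈ H, setting u* = Σ_{j=1}^{n} ⟨u, φ_j⟩ ψ_j, one has B(u − u*, u − u*) = inf { B(u − v, u − v) : v ∈ span{ψ_1, …, ψ_n} }, and the infimum is attained at v = u*. -/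

import Mathlib

open scoped RealInnerProductSpace

/-- Optimal approximation property of the biorthogonal energy-minimizing
basis (Theorem 3.2 of the paper, abstract form): the Galerkin approximation
`u* = ∑ ⟪u, φ j⟫ • ψ j` realizes the least value of the energy of the error
among all elements of the span of the `ψ j`. -/
theorem energy_optimal_approximation
    {H : Type*} [NormedAddCommGroup H] [InnerProductSpace ℝ H]
    (B : H →ₗ[ℝ] H →ₗ[ℝ] ℝ) (hBsymm : ∀ x y : H, B x y = B y x)
    (hBpos : ∀ v : H, 0 ≤ B v v)
    (n : ℕ) (ψ φ : Fin n → H)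
    (hbiortho : ∀ i j : Fin n, ⟪ψ i, φ j⟫ = if i = j then (1 : ℝ) else 0)
    (hortho : ∀ i : Fin n, ∀ v : H, (∀ j : Fin n, ⟪v, φ j⟫ = 0) → B (ψ i) v = 0)
    (u : H) :
    IsLeast {r : ℝ | ∃ v ∈ Submodule.span ℝ (Set.range ψ), r = B (u - v) (u - v)}
      (B (u - ∑ j, ⟪u, φ j⟫ • ψ j) (u - ∑ j, ⟪u, φ j⟫ • ψ j)) := by
  set s : H := ∑ j, ⟪u, φ j⟫ • ψ j with hs
  have hmem : s ∈ Submodule.span ℝ (Set.range ψ) :=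
    Submodule.sum_mem _ fun j _ =>
      Submodule.smul_mem _ _ (Submodule.subset_span ⟨j, rfl⟩)
  have hw : ∀ j : Fin n, ⟪u - s, φ j⟫ = 0 := by
    intro j
    rw [inner_sub_left, hs, sum_inner]
    simp [real_inner_smul_left, hbiortho]
  have horth : ∀ v ∈ Submodule.span ℝ (Set.range ψ), B v (u - s) = 0 := by
    intro v hv
    induction hv using Submodule.span_induction with
    | mem x hx =>
      obtain ⟨i, rfl⟩ := hx
      exact hortho i _ hw
    | zero => simp
    | add x y _ _ hx hy => rw [map_add, LinearMap.add_apply, hx, hy, add_zero]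
    | smul a x _ hx => rw [map_smul, LinearMap.smul_apply, hx, smul_zero]
  refine ⟨⟨s, hmem, rfl⟩, ?_⟩
  rintro r ⟨v, hv, rfl⟩
  have h1 := horth (s - v) (Submodule.sub_mem _ hmem hv)
  have h2 := hBsymm (u - s) (s - v)
  have h3 := hBpos (s - v)
  have h4 : u - v = (u - s) + (s - v) := by abel
  have h5 : B (u - v) (u - v) = B (u - s) (u - s) + B (u - s) (s - v)
      + (B (s - v) (u - s) + B (s - v) (s - v)) := by
    rw [h4, map_add B, LinearMap.add_apply, map_add, map_add]
  linarith
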